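/- arXiv:2101.09024 — 2 statements merged into one kernel-verified Lean document; each statement's English description precedes it below -/
import Mathlib

section
/- There exist a constant C > 0 and a valid online rotation strategy σ such that for every nonempty finite stream L consisting of n pieces, ALG_σ(L) ≤ C·√n·OPT(L), where the cost is the area of the bounding box. (An O(√n)-competitive online algorithm for area minimization with rotations by 90° allowed.) -/
open Set

/-- A piece is a pair (w,h) of (intended positive) real numbers. -/
abbrev Piece := ℝ × ℝ

/-- Both edge lengths of the piece are positive. -/
def PiecePos (p : Piece) : Prop := 0 < p.1 ∧ 0 < p.2

/-- The axis-parallel closed rectangle obtained by placing piece `p` by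
translation at the point `q`. -/
def placedRect (p : Piece) (q : ℝ × ℝ) : Set (ℝ × ℝ) :=
  Set.Icc q.1 (q.1 + p.1) ×ˢ Set.Icc q.2 (q.2 + p.2)

/-- Width of the axis-parallel bounding box of a set in the plane. -/
noncomputable def boxWidth (S : Set (ℝ × ℝ)) : ℝ :=
  sSup (Prod.fst '' S) - sInf (Prod.fst '' S)

/-- Height of the axis-parallel bounding box of a set in the plane. -/
noncomputable def boxHeight (S : Set (ℝ × ℝ)) : ℝ :=
  sSup (Prod.snd '' S) - sInf (Prod.snd '' S)

/-! ### Translations only -/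

/-- `pos` is a packing (by translations) of the list `L` of pieces:
the placed rectangles have pairwise disjoint interiors. -/
def IsPacking (L : List Piece) (pos : Fin L.length → ℝ × ℝ) : Prop :=
  ∀ i j : Fin L.length, i ≠ j →
    Disjoint (interior (placedRect (L.get i) (pos i)))
             (interior (placedRect (L.get j) (pos j)))

/-- The union of the placed rectangles. -/
def packedSet (L : List Piece) (pos : Fin L.length → ℝ × ℝ) : Set (ℝ × ℝ) :=
  ⋃ i : Fin L.length, placedRect (L.get i) (pos i)

/-- Perimeter of the bounding box of a packing. -/
noncomputable def periCost (L : List Piece) (pos : Fin L.length → ℝ × ℝ) : ℝ :=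
  2 * (boxWidth (packedSet L pos) + boxHeight (packedSet L pos))

/-- Area of the bounding box of a packing. -/
noncomputable def areaCost (L : List Piece) (pos : Fin L.length → ℝ × ℝ) : ℝ :=
  boxWidth (packedSet L pos) * boxHeight (packedSet L pos)

/-- Optimal offline bounding-box perimeter for the pieces of `L`. -/
noncomputable def optPeri (L : List Piece) : ℝ :=
  sInf { c | ∃ pos : Fin L.length → ℝ × ℝ, IsPacking L pos ∧ periCost L pos = c }

/-- Optimal offline bounding-box area for the pieces of `L`. -/
noncomputable def optArea (L : List Piece) : ℝ :=
  sInf { c | ∃ pos : Fin L.length → ℝ × ℝ, IsPacking L pos ∧ areaCost L pos = c }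

/-- The positions chosen by the online strategy `σ` on the stream `L`:
the `i`-th piece is placed at the point chosen by `σ` as a function of the
first `i+1` pieces. -/
def onlinePos (σ : List Piece → ℝ × ℝ) (L : List Piece) :
    Fin L.length → ℝ × ℝ :=
  fun i => σ (L.take ((i : ℕ) + 1))

/-- `σ` is a valid online translation strategy: on every stream of pieces it
produces a packing. -/
def StrategyValid (σ : List Piece → ℝ × ℝ) : Prop :=
  ∀ L : List Piece, (∀ p ∈ L, PiecePos p) → IsPacking L (onlinePos σ L)

/-- Perimeter of the bounding box of the packing produced by `σ` on `L`. -/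
noncomputable def algPeri (σ : List Piece → ℝ × ℝ) (L : List Piece) : ℝ :=
  periCost L (onlinePos σ L)

/-- Area of the bounding box of the packing produced by `σ` on `L`. -/
noncomputable def algArea (σ : List Piece → ℝ × ℝ) (L : List Piece) : ℝ :=
  areaCost L (onlinePos σ L)

/-! ### Rotations by 90° allowed -/

/-- The piece `p` in the orientation given by `r`: rotated by 90° if `r` is
`true`. -/
def orient (p : Piece) (r : Bool) : Piece := if r then (p.2, p.1) else p

/-- `pos, rot` is a packing with rotations of the list `L` of pieces. -/
def IsRotPacking (L : List Piece) (pos : Fin L.length → ℝ × ℝ)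
    (rot : Fin L.length → Bool) : Prop :=
  ∀ i j : Fin L.length, i ≠ j →
    Disjoint (interior (placedRect (orient (L.get i) (rot i)) (pos i)))
             (interior (placedRect (orient (L.get j) (rot j)) (pos j)))

/-- The union of the placed (possibly rotated) rectangles. -/
def packedRotSet (L : List Piece) (pos : Fin L.length → ℝ × ℝ)
    (rot : Fin L.length → Bool) : Set (ℝ × ℝ) :=
  ⋃ i : Fin L.length, placedRect (orient (L.get i) (rot i)) (pos i)

/-- Perimeter of the bounding box of a packing with rotations. -/
noncomputable def periRotCost (L : List Piece) (pos : Fin L.length → ℝ × ℝ)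
    (rot : Fin L.length → Bool) : ℝ :=
  2 * (boxWidth (packedRotSet L pos rot) + boxHeight (packedRotSet L pos rot))

/-- Area of the bounding box of a packing with rotations. -/
noncomputable def areaRotCost (L : List Piece) (pos : Fin L.length → ℝ × ℝ)
    (rot : Fin L.length → Bool) : ℝ :=
  boxWidth (packedRotSet L pos rot) * boxHeight (packedRotSet L pos rot)

/-- Optimal offline bounding-box perimeter with rotations allowed. -/
noncomputable def optRotPeri (L : List Piece) : ℝ :=
  sInf { c | ∃ (pos : Fin L.length → ℝ × ℝ) (rot : Fin L.length → Bool),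
    IsRotPacking L pos rot ∧ periRotCost L pos rot = c }

/-- Optimal offline bounding-box area with rotations allowed. -/
noncomputable def optRotArea (L : List Piece) : ℝ :=
  sInf { c | ∃ (pos : Fin L.length → ℝ × ℝ) (rot : Fin L.length → Bool),
    IsRotPacking L pos rot ∧ areaRotCost L pos rot = c }

/-- The positions chosen by the online rotation strategy `σ` on the stream `L`. -/
def onlineRotPos (σ : List Piece → (ℝ × ℝ) × Bool) (L : List Piece) :
    Fin L.length → ℝ × ℝ :=
  fun i => (σ (L.take ((i : ℕ) + 1))).1

/-- The orientations chosen by the online rotation strategy `σ` on the stream `L`. -/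
def onlineRot (σ : List Piece → (ℝ × ℝ) × Bool) (L : List Piece) :
    Fin L.length → Bool :=
  fun i => (σ (L.take ((i : ℕ) + 1))).2

/-- `σ` is a valid online rotation strategy: on every stream of pieces it
produces a packing with rotations. -/
def RotStrategyValid (σ : List Piece → (ℝ × ℝ) × Bool) : Prop :=
  ∀ L : List Piece, (∀ p ∈ L, PiecePos p) →
    IsRotPacking L (onlineRotPos σ L) (onlineRot σ L)

/-- Perimeter of the bounding box of the packing produced by `σ` on `L`. -/
noncomputable def algRotPeri (σ : List Piece → (ℝ × ℝ) × Bool) (L : List Piece) : ℝ :=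
  periRotCost L (onlineRotPos σ L) (onlineRot σ L)

/-- Area of the bounding box of the packing produced by `σ` on `L`. -/
noncomputable def algRotArea (σ : List Piece → (ℝ × ℝ) × Bool) (L : List Piece) : ℝ :=
  areaRotCost L (onlineRotPos σ L) (onlineRot σ L)

/-! ### Square pieces, bounding-square cost -/

/-- The axis-parallel closed square of side `s` placed at the point `q`. -/
def placedSq (s : ℝ) (q : ℝ × ℝ) : Set (ℝ × ℝ) :=
  Set.Icc q.1 (q.1 + s) ×ˢ Set.Icc q.2 (q.2 + s)

/-- `pos` is a packing of the list `L` of square pieces. -/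
def IsSqPacking (L : List ℝ) (pos : Fin L.length → ℝ × ℝ) : Prop :=
  ∀ i j : Fin L.length, i ≠ j →
    Disjoint (interior (placedSq (L.get i) (pos i)))
             (interior (placedSq (L.get j) (pos j)))

/-- The union of the placed squares. -/
def packedSqSet (L : List ℝ) (pos : Fin L.length → ℝ × ℝ) : Set (ℝ × ℝ) :=
  ⋃ i : Fin L.length, placedSq (L.get i) (pos i)

/-- Area of the smallest axis-parallel square containing all placed squares. -/
noncomputable def sqCost (L : List ℝ) (pos : Fin L.length → ℝ × ℝ) : ℝ :=
  (max (boxWidth (packedSqSet L pos)) (boxHeight (packedSqSet L pos))) ^ 2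

/-- Optimal offline bounding-square area for the square pieces of `L`. -/
noncomputable def optSq (L : List ℝ) : ℝ :=
  sInf { c | ∃ pos : Fin L.length → ℝ × ℝ, IsSqPacking L pos ∧ sqCost L pos = c }

/-- The positions chosen by the online strategy `σ` on the stream `L` of
square pieces. -/
def onlineSqPos (σ : List ℝ → ℝ × ℝ) (L : List ℝ) : Fin L.length → ℝ × ℝ :=
  fun i => σ (L.take ((i : ℕ) + 1))

/-- `σ` is a valid online translation strategy for square pieces. -/
def SqStrategyValid (σ : List ℝ → ℝ × ℝ) : Prop :=
  ∀ L : List ℝ, (∀ s ∈ L, 0 < s) → IsSqPacking L (onlineSqPos σ L)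

/-- Bounding-square area of the packing produced by `σ` on `L`. -/
noncomputable def algSq (σ : List ℝ → ℝ × ℝ) (L : List ℝ) : ℝ :=
  sqCost L (onlineSqPos σ L)

open Classical in
/-- The shelf receiving a piece of length `w` and height class `k`: an existing shelf of that class
whose length stays at most `X`, or a new one. -/
noncomputable def chooseShelf (m : ℕ) (kind : ℕ → ℤ) (len : ℕ → ℝ) (k : ℤ) (w X : ℝ) : ℕ :=
  if h : ∃ j < m, kind j = k ∧ len j + w ≤ X then h.choose else m

lemma chooseShelf_spec (m : ℕ) (kind : ℕ → ℤ) (len : ℕ → ℝ) (k : ℤ) (w X : ℝ) :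
    (chooseShelf m kind len k w X < m ∧ kind (chooseShelf m kind len k w X) = k ∧
      len (chooseShelf m kind len k w X) + w ≤ X) ∨
    (chooseShelf m kind len k w X = m ∧ ∀ j < m, kind j = k → X < len j + w) := by
  unfold chooseShelf
  split_ifs with h
  · exact Or.inl h.choose_spec
  · right
    refine ⟨rfl, fun j hj hk => ?_⟩
    by_contra hlt
    exact h ⟨j, hj, hk, not_lt.1 hlt⟩

/-- The state of the shelf algorithm. Shelf `j < shelves` has height `4 ^ kind j` and is filled up
to `len j`; shelves are stacked in the order in which they are opened. -/
structure ShelfState where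
  /-- number of pieces -/
  count : ℕ
  /-- longest edge -/
  long : ℝ
  /-- largest short edge -/
  short : ℝ
  /-- total area -/
  area : ℝ
  /-- current bound on the shelf lengths -/
  limit : ℝ
  /-- number of shelves -/
  shelves : ℕ
  /-- height classes of the shelves -/
  kind : ℕ → ℤ
  /-- filled lengths of the shelves -/
  len : ℕ → ℝ
  /-- placement of the last piece -/
  last : (ℝ × ℝ) × Bool

namespace ShelfState

/-- The state before the first piece. -/
noncomputable def start : ShelfState :=
  ⟨0, 0, 0, 0, 0, 0, fun _ => 0, fun _ => 0, ((0, 0), false)⟩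

/-- The height at which shelf `j` starts. -/
noncomputable def base (s : ShelfState) (j : ℕ) : ℝ := ∑ i ∈ Finset.range j, (4 : ℝ) ^ s.kind i

/-- Length bound for the shelves after the arrival of `p`. -/
noncomputable def nextLimit (s : ShelfState) (p : Piece) : ℝ :=
  max s.limit (2 * √(max s.long (max p.1 p.2) ^ 2 +
    max s.long (max p.1 p.2) * (s.area + p.1 * p.2) / max s.short (min p.1 p.2)))

/-- The shelf receiving `p`. -/
noncomputable def nextShelf (s : ShelfState) (p : Piece) : ℕ :=
  chooseShelf s.shelves s.kind s.len (Int.clog 4 (min p.1 p.2)) (max p.1 p.2) (s.nextLimit p)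

/-- The state after the arrival of `p`, which is placed with its long edge horizontal. -/
noncomputable def step (s : ShelfState) (p : Piece) : ShelfState where
  count := s.count + 1
  long := max s.long (max p.1 p.2)
  short := max s.short (min p.1 p.2)
  area := s.area + p.1 * p.2
  limit := s.nextLimit p
  shelves := max s.shelves (s.nextShelf p + 1)
  kind := Function.update s.kind (s.nextShelf p) (Int.clog 4 (min p.1 p.2))
  len := Function.update s.len (s.nextShelf p) (s.len (s.nextShelf p) + max p.1 p.2)
  last := ((s.len (s.nextShelf p), s.base (s.nextShelf p)), decide (p.1 < p.2))

/-- The number of shelves of height class `k`. -/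
noncomputable def kindCount (s : ShelfState) (k : ℤ) : ℕ :=
  ((Finset.range s.shelves).filter (fun j => s.kind j = k)).card

/-- The invariants of the shelf algorithm. -/
structure Inv (s : ShelfState) : Prop where
  long_nonneg : 0 ≤ s.long
  short_nonneg : 0 ≤ s.short
  area_nonneg : 0 ≤ s.area
  limit_nonneg : 0 ≤ s.limit
  area_le : s.area ≤ s.count * (s.long * s.short)
  limit_sq_le : s.limit ^ 2 ≤ 8 * s.count * s.long ^ 2
  len_nonneg : ∀ j, 0 ≤ s.len j
  len_le : ∀ j, s.len j ≤ s.limit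
  len_eq_zero : ∀ j, s.shelves ≤ j → s.len j = 0
  sum_len_le : ∑ j ∈ Finset.range s.shelves, s.len j ≤ s.count * s.long
  sum_len_mul_le : ∑ j ∈ Finset.range s.shelves, s.len j * (4 : ℝ) ^ s.kind j ≤ 4 * s.area
  kind_le : ∀ j < s.shelves, 0 < s.short ∧ s.kind j ≤ Int.clog 4 s.short
  crowd_short : ∀ k, ((s.kindCount k - 1 : ℕ) : ℝ) ^ 2 * 4 ^ k ≤ 4 * s.count * s.short
  crowd_limit : ∀ k, ((s.kindCount k - 1 : ℕ) : ℝ) ^ 2 * 4 ^ k * s.limit ^ 2 ≤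
    16 * s.count * (s.long * (s.area + s.long * s.short))

lemma inv_start : start.Inv := by
  have h : ∀ k, start.kindCount k = 0 := fun k =>
    Finset.card_eq_zero.2 (Finset.filter_false_of_mem fun j hj => by simp [start] at hj)
  constructor <;> (try simp only [h]) <;> simp [start]

lemma step_cases (s : ShelfState) (p : Piece) :
    (s.nextShelf p < s.shelves ∧ (s.step p).shelves = s.shelves ∧ (s.step p).kind = s.kind ∧
      s.kind (s.nextShelf p) = Int.clog 4 (min p.1 p.2) ∧
      s.len (s.nextShelf p) + max p.1 p.2 ≤ s.nextLimit p) ∨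
    (s.nextShelf p = s.shelves ∧ (s.step p).shelves = s.shelves + 1 ∧
      ∀ j < s.shelves, s.kind j = Int.clog 4 (min p.1 p.2) →
        s.nextLimit p < s.len j + max p.1 p.2) := by
  rcases chooseShelf_spec s.shelves s.kind s.len (Int.clog 4 (min p.1 p.2)) (max p.1 p.2)
    (s.nextLimit p) with ⟨h1, h2, h3⟩ | ⟨h1, h2⟩
  · left
    refine ⟨h1, max_eq_left h1, ?_, h2, h3⟩
    change Function.update s.kind (s.nextShelf p) (Int.clog 4 (min p.1 p.2)) = s.kind
    rw [← h2]
    exact Function.update_eq_self _ _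
  · right
    refine ⟨h1, ?_, h2⟩
    change max s.shelves (s.nextShelf p + 1) = _
    rw [show s.nextShelf p = s.shelves from h1]
    simp

lemma shelves_le_step (s : ShelfState) (p : Piece) : s.shelves ≤ (s.step p).shelves :=
  le_max_left _ _

lemma step_kind_of_lt (s : ShelfState) (p : Piece) {j : ℕ} (hj : j < s.shelves) :
    (s.step p).kind j = s.kind j := by
  rcases s.step_cases p with ⟨_, _, h, _⟩ | ⟨h, _⟩
  · rw [h]
  · exact Function.update_of_ne (by omega) _ _

lemma step_kind_cur (s : ShelfState) (p : Piece) :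
    (s.step p).kind (s.nextShelf p) = Int.clog 4 (min p.1 p.2) :=
  Function.update_self _ _ _

lemma step_len_cur (s : ShelfState) (p : Piece) :
    (s.step p).len (s.nextShelf p) = s.len (s.nextShelf p) + max p.1 p.2 :=
  Function.update_self _ _ _

lemma step_len_of_ne (s : ShelfState) (p : Piece) {j : ℕ} (hj : j ≠ s.nextShelf p) :
    (s.step p).len j = s.len j :=
  Function.update_of_ne hj _ _

lemma nextShelf_le (s : ShelfState) (p : Piece) : s.nextShelf p ≤ s.shelves := by
  rcases s.step_cases p with h | h
  · exact h.1.le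
  · exact h.1.le

lemma nextShelf_lt_step (s : ShelfState) (p : Piece) : s.nextShelf p < (s.step p).shelves :=
  le_max_right s.shelves (s.nextShelf p + 1)

/-- Adding a piece changes a weighted sum of shelf lengths by its own contribution. -/
lemma sum_step_len (s : ShelfState) (hs : s.Inv) (p : Piece) (f : ℤ → ℝ) :
    ∑ j ∈ Finset.range (s.step p).shelves, (s.step p).len j * f ((s.step p).kind j) =
      ∑ j ∈ Finset.range s.shelves, s.len j * f (s.kind j) +
        max p.1 p.2 * f (Int.clog 4 (min p.1 p.2)) := by
  have key : ∀ j, (s.step p).len j * f ((s.step p).kind j) =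
      s.len j * f ((s.step p).kind j) +
        if s.nextShelf p = j then max p.1 p.2 * f (Int.clog 4 (min p.1 p.2)) else 0 := by
    intro j
    split_ifs with h
    · rw [← h, step_len_cur, step_kind_cur]; ring
    · rw [step_len_of_ne _ _ (Ne.symm h)]; ring
  rw [Finset.sum_congr rfl fun j _ => key j, Finset.sum_add_distrib, Finset.sum_ite_eq,
    if_pos (Finset.mem_range.2 (s.nextShelf_lt_step p))]
  congr 1
  rw [← Finset.sum_subset (Finset.range_mono (s.shelves_le_step p))]
  · exact Finset.sum_congr rfl fun j hj => by rw [step_kind_of_lt _ _ (Finset.mem_range.1 hj)]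
  · intro j _ hj
    rw [hs.len_eq_zero j (by simpa using hj), zero_mul]

lemma kindCount_step_of_ne (s : ShelfState) (p : Piece) {k : ℤ}
    (hk : k ≠ Int.clog 4 (min p.1 p.2)) : (s.step p).kindCount k = s.kindCount k := by
  unfold kindCount
  congr 1
  ext j
  simp only [Finset.mem_filter, Finset.mem_range]
  constructor
  · rintro ⟨h1, h2⟩
    have hj : j < s.shelves := by
      rcases s.step_cases p with ⟨_, h, _⟩ | ⟨h, h', _⟩
      · omega
      · rcases Nat.lt_succ_iff_lt_or_eq.1 (h' ▸ h1) with h3 | h3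
        · exact h3
        · rw [h3, ← h, step_kind_cur] at h2
          exact absurd h2.symm hk
    exact ⟨hj, by rw [← h2, step_kind_of_lt _ _ hj]⟩
  · rintro ⟨h1, h2⟩
    exact ⟨h1.trans_le (s.shelves_le_step p), by rw [step_kind_of_lt _ _ h1, h2]⟩

/-- If a shelf is opened for `p`, then the number of shelves of its class grows by one, and all
older shelves of the class are long. -/
lemma kindCount_step_cases (s : ShelfState) (p : Piece) (k : ℤ) :
    (s.step p).kindCount k = s.kindCount k ∨
    ((s.step p).kindCount k = s.kindCount k + 1 ∧
      ∀ j < s.shelves, s.kind j = k → s.nextLimit p < s.len j + max p.1 p.2) := by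
  by_cases hk : k = Int.clog 4 (min p.1 p.2)
  · rcases s.step_cases p with ⟨_, h1, h2, _⟩ | ⟨h, h1, h2⟩
    · left
      unfold kindCount
      rw [h1, h2]
    · right
      refine ⟨?_, hk ▸ h2⟩
      unfold kindCount
      rw [h1, Finset.range_add_one, Finset.filter_insert, if_pos (by rw [← h, step_kind_cur, hk]),
        Finset.card_insert_of_notMem (by simp)]
      congr 2
      exact Finset.filter_congr fun j hj => by rw [step_kind_of_lt _ _ (Finset.mem_range.1 hj)]
  · exact Or.inl (s.kindCount_step_of_ne p hk)

lemma step_len_le (s : ShelfState) (p : Piece) (hp : PiecePos p) (j : ℕ) :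
    s.len j ≤ (s.step p).len j := by
  by_cases h : j = s.nextShelf p
  · rw [h, step_len_cur]
    linarith [hp.1, le_max_left p.1 p.2]
  · rw [step_len_of_ne _ _ h]

lemma sum_len_kind_le (s : ShelfState) (hs : s.Inv) (k : ℤ) (f : ℤ → ℝ) (hf : ∀ i, 0 ≤ f i) :
    (∑ j ∈ (Finset.range s.shelves).filter (fun j => s.kind j = k), s.len j) * f k ≤
      ∑ j ∈ Finset.range s.shelves, s.len j * f (s.kind j) := by
  rw [Finset.sum_mul]
  refine le_trans (Finset.sum_le_sum fun j hj => ?_)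
    (Finset.sum_le_sum_of_subset_of_nonneg (Finset.filter_subset _ _)
      fun j _ _ => mul_nonneg (hs.len_nonneg j) (hf _))
  rw [(Finset.mem_filter.1 hj).2]

/-- The numerical bounds that hold after a piece `p` arrives, before it is put on a shelf. -/
lemma step_bounds (s : ShelfState) (hs : s.Inv) (p : Piece) (hp : PiecePos p) :
    0 < (s.step p).long ∧ 0 < (s.step p).short ∧ 0 < (s.step p).area ∧
    (s.step p).area ≤ (s.step p).count * ((s.step p).long * (s.step p).short) ∧
    2 * (s.step p).long ≤ (s.step p).limit ∧
    4 * ((s.step p).long * (s.step p).area) ≤ (s.step p).limit ^ 2 * (s.step p).short ∧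
    ((s.step p).limit = s.limit ∨ (s.step p).limit ^ 2 * (s.step p).short =
      4 * (s.step p).long * ((s.step p).area + (s.step p).long * (s.step p).short)) := by
  obtain ⟨hp1, hp2⟩ := hp
  have hW : 0 < (s.step p).long :=
    (lt_max_of_lt_left hp1).trans_le (le_max_right s.long (max p.1 p.2))
  have hH : 0 < (s.step p).short :=
    (lt_min hp1 hp2).trans_le (le_max_right s.short (min p.1 p.2))
  have hA : 0 < (s.step p).area := by
    change 0 < s.area + p.1 * p.2
    have := hs.area_nonneg
    positivity
  have hX : (s.step p).limit = max s.limit (2 * √((s.step p).long ^ 2 +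
    (s.step p).long * (s.step p).area / (s.step p).short)) := rfl
  set r := √((s.step p).long ^ 2 +
    (s.step p).long * (s.step p).area / (s.step p).short) with hr
  have hr0 : 0 ≤ r := Real.sqrt_nonneg _
  have hr2 : r ^ 2 * (s.step p).short =
      (s.step p).long * ((s.step p).area + (s.step p).long * (s.step p).short) := by
    rw [hr, Real.sq_sqrt (by positivity)]
    field_simp
    ring
  have hXr : 2 * r ≤ (s.step p).limit := hX ▸ le_max_right _ _
  have hXr2 : 4 * r ^ 2 ≤ (s.step p).limit ^ 2 := by nlinarith
  refine ⟨hW, hH, hA, ?_, ?_, ?_, ?_⟩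
  · have h1 : s.long ≤ (s.step p).long := le_max_left _ _
    have h2 : s.short ≤ (s.step p).short := le_max_left _ _
    have h3 : p.1 * p.2 ≤ (s.step p).long * (s.step p).short := by
      rw [← max_mul_min p.1 p.2]
      exact mul_le_mul (le_max_right _ _) (le_max_right _ _) (le_min hp1.le hp2.le) hW.le
    have h4 : s.long * s.short ≤ (s.step p).long * (s.step p).short :=
      mul_le_mul h1 h2 hs.short_nonneg hW.le
    have h5 : (s.step p).area = s.area + p.1 * p.2 := rfl
    have h6 : ((s.step p).count : ℝ) = s.count + 1 := by simp [step]
    rw [h5, h6]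
    have := mul_le_mul_of_nonneg_left h4 (Nat.cast_nonneg (α := ℝ) s.count)
    linarith [hs.area_le]
  · refine le_trans ?_ hXr
    have : (s.step p).long ≤ r := Real.le_sqrt_of_sq_le (by
      have : 0 ≤ (s.step p).long * (s.step p).area / (s.step p).short := by positivity
      linarith)
    linarith
  · have := mul_le_mul_of_nonneg_right hXr2 hH.le
    have : 0 ≤ (s.step p).long * ((s.step p).long * (s.step p).short) := by positivity
    nlinarith
  · rcases max_choice s.limit (2 * r) with h | h
    · exact Or.inl (hX.trans h)
    · right
      rw [hX, h]
      linarith [hr2]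

/-- Arithmetic of opening a new shelf in a class of height `q` that already has `c` shelves, all of
length at least `X / 2`: `n` pieces of total area `A`, long edges at most `W`. -/
lemma crowd_of_full {n W H A X q c S : ℝ} (hc : 0 ≤ c) (hX : 0 < X)
    (hq : 0 < q) (hS : c * (X / 2) ≤ S) (hn : S ≤ n * W) (hA : S * q ≤ 4 * A)
    (hXA : 4 * (W * A) ≤ X ^ 2 * H) (hn0 : 0 ≤ n) :
    c ^ 2 * q * X ^ 2 ≤ 16 * n * (W * A) ∧ c ^ 2 * q ≤ 4 * n * H := by
  have h1 : c * X ≤ 2 * (n * W) := by linarith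
  have h2 : c * X * q ≤ 8 * A := by nlinarith
  have h3 : 0 ≤ c * X := by positivity
  have h4 : c ^ 2 * q * X ^ 2 ≤ 16 * n * (W * A) := by
    calc c ^ 2 * q * X ^ 2 = (c * X) * (c * X * q) := by ring
      _ ≤ (2 * (n * W)) * (8 * A) := mul_le_mul h1 h2 (by positivity) (by linarith)
      _ = _ := by ring
  refine ⟨h4, ?_⟩
  have h5 : c ^ 2 * q * X ^ 2 ≤ 4 * n * H * X ^ 2 := by nlinarith
  exact le_of_mul_le_mul_right h5 (by positivity)

lemma inv_step (s : ShelfState) (hs : s.Inv) (p : Piece) (hp : PiecePos p) : (s.step p).Inv := by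
  obtain ⟨hW, hH, hA, hAn, hXW, hXA, hX⟩ := s.step_bounds hs p hp
  have hp12 : 0 < max p.1 p.2 := lt_max_of_lt_left hp.1
  have hmin : 0 < min p.1 p.2 := lt_min hp.1 hp.2
  have hWs : s.long ≤ (s.step p).long := le_max_left _ _
  have hHs : s.short ≤ (s.step p).short := le_max_left _ _
  have hwW : max p.1 p.2 ≤ (s.step p).long := le_max_right _ _
  have hhH : min p.1 p.2 ≤ (s.step p).short := le_max_right _ _
  have hXs : s.limit ≤ (s.step p).limit := le_max_left _ _
  have hAs : (s.step p).area = s.area + p.1 * p.2 := rfl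
  have hns : ((s.step p).count : ℝ) = s.count + 1 := by simp [step]
  have hn0 : (0 : ℝ) ≤ s.count := Nat.cast_nonneg _
  have hX0 : 0 < (s.step p).limit := by linarith
  have hnW : s.count * s.long ≤ (s.step p).count * (s.step p).long := by
    rw [hns]; nlinarith [hs.long_nonneg]
  have hL : s.long * (s.area + s.long * s.short) ≤
      (s.step p).long * ((s.step p).area + (s.step p).long * (s.step p).short) := by
    have := hs.long_nonneg
    have := hs.short_nonneg
    have := hs.area_nonneg
    have : s.area ≤ (s.step p).area := by rw [hAs]; linarith [mul_pos hp.1 hp.2]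
    gcongr
  have hkind : ∀ j < (s.step p).shelves, 0 < (s.step p).short ∧
      (s.step p).kind j ≤ Int.clog 4 (s.step p).short := by
    intro j hj
    refine ⟨hH, ?_⟩
    by_cases h : j = s.nextShelf p
    · rw [h, step_kind_cur]
      exact Int.clog_mono_right hmin hhH
    · have hj' : j < s.shelves := by
        rcases s.step_cases p with h' | h' <;> omega
      rw [step_kind_of_lt _ _ hj']
      obtain ⟨hpos, hle⟩ := hs.kind_le j hj'
      exact hle.trans (Int.clog_mono_right hpos hHs)
  have hsumA : ∑ j ∈ Finset.range s.shelves, s.len j * (4 : ℝ) ^ s.kind j ≤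
      4 * (s.step p).area := by
    have := hs.sum_len_mul_le
    rw [hAs]; linarith [mul_pos hp.1 hp.2]
  have hcrowd : ∀ k, ((s.step p).kindCount k - 1 : ℕ) = s.kindCount k - 1 ∨
      (((s.step p).kindCount k - 1 : ℕ) : ℝ) ^ 2 * 4 ^ k * (s.step p).limit ^ 2 ≤
        16 * (s.step p).count * ((s.step p).long * (s.step p).area) ∧
      (((s.step p).kindCount k - 1 : ℕ) : ℝ) ^ 2 * 4 ^ k ≤
        4 * (s.step p).count * (s.step p).short := by
    intro k
    rcases s.kindCount_step_cases p k with h | ⟨h, hfull⟩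
    · exact Or.inl (by rw [h])
    · right
      rw [h, Nat.add_sub_cancel]
      refine crowd_of_full (Nat.cast_nonneg _) hX0 (by positivity)
        (S := ∑ j ∈ (Finset.range s.shelves).filter (fun j => s.kind j = k), s.len j)
        ?_ ?_ ?_ hXA (Nat.cast_nonneg _)
      · rw [kindCount, ← nsmul_eq_mul]
        refine Finset.card_nsmul_le_sum _ _ _ fun j hj => ?_
        rw [Finset.mem_filter, Finset.mem_range] at hj
        have h1 := hfull j hj.1 hj.2
        change (s.step p).limit < _ at h1
        linarith
      · have := s.sum_len_kind_le hs k (fun _ => 1) (fun _ => zero_le_one)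
        simp only [mul_one] at this
        exact (this.trans hs.sum_len_le).trans hnW
      · exact (s.sum_len_kind_le hs k (fun i => 4 ^ i) (fun _ => by positivity)).trans hsumA
  have hshort : ∀ k, (((s.step p).kindCount k - 1 : ℕ) : ℝ) ^ 2 * 4 ^ k ≤
      4 * (s.step p).count * (s.step p).short := by
    intro k
    rcases hcrowd k with h | h
    · rw [h]
      refine (hs.crowd_short k).trans ?_
      have := hs.short_nonneg
      rw [hns]
      gcongr
      linarith
    · exact h.2
  refine ⟨hW.le, hH.le, hA.le, hX0.le, hAn, ?_, ?_, ?_, ?_, ?_, ?_, hkind, hshort, ?_⟩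
  · rcases hX with h | h
    · rw [h]
      refine hs.limit_sq_le.trans ?_
      have := hs.long_nonneg
      rw [hns]
      gcongr
      linarith
    · refine le_of_mul_le_mul_right ?_ hH
      rw [h]
      have h1 : (1 : ℝ) ≤ (s.step p).count := by rw [hns]; linarith
      have h2 : (s.step p).long * (s.step p).short ≤
          (s.step p).count * ((s.step p).long * (s.step p).short) :=
        le_mul_of_one_le_left (by positivity) h1
      calc _ ≤ 4 * (s.step p).long *
            (2 * ((s.step p).count * ((s.step p).long * (s.step p).short))) := by
            gcongr; linarith
        _ = _ := by ring
  · exact fun j => (hs.len_nonneg j).trans (s.step_len_le p hp j)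
  · intro j
    by_cases h : j = s.nextShelf p
    · rw [h, step_len_cur]
      rcases s.step_cases p with h' | h'
      · exact h'.2.2.2.2
      · rw [h'.1, hs.len_eq_zero _ le_rfl]
        linarith
    · rw [step_len_of_ne _ _ h]
      exact (hs.len_le j).trans hXs
  · intro j hj
    rw [step_len_of_ne _ _ ((s.nextShelf_lt_step p).trans_le hj).ne']
    exact hs.len_eq_zero j ((s.shelves_le_step p).trans hj)
  · have := s.sum_step_len hs p (fun _ => 1)
    simp only [mul_one] at this
    rw [this, hns]
    have := mul_le_mul_of_nonneg_left hWs hn0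
    linarith [hs.sum_len_le]
  · rw [s.sum_step_len hs p (fun i => 4 ^ i), hAs]
    have h1 : (4 : ℝ) ^ (Int.clog 4 (min p.1 p.2) - 1) < min p.1 p.2 := by
      simpa using Int.zpow_pred_clog_lt_self (b := 4) (by norm_num) hmin
    rw [zpow_sub_one₀ (by norm_num)] at h1
    have h2 := mul_le_mul_of_nonneg_left
      (show (4 : ℝ) ^ Int.clog 4 (min p.1 p.2) ≤ 4 * min p.1 p.2 by linarith) hp12.le
    have h3 := max_mul_min p.1 p.2
    linarith [hs.sum_len_mul_le]
  · intro k
    rcases hcrowd k with h | h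
    · rcases hX with h' | h'
      · rw [h, h']
        refine (hs.crowd_limit k).trans ?_
        have := hs.long_nonneg
        have := hs.short_nonneg
        have := hs.area_nonneg
        rw [hns]
        gcongr
        linarith
      · refine le_of_mul_le_mul_right ?_ hH
        rw [mul_assoc _ (_ ^ 2) _, h']
        have := mul_le_mul_of_nonneg_right (hshort k) (show 0 ≤ 4 * (s.step p).long *
          ((s.step p).area + (s.step p).long * (s.step p).short) by positivity)
        linarith
    · refine h.1.trans ?_
      gcongr
      have : 0 < (s.step p).long * (s.step p).short := by positivity
      linarith

/-- The total height of the shelves is small compared with `√n · max (area, long · short)`. -/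
lemma Inv.limit_mul_base_le {s : ShelfState} (hs : s.Inv) {B : ℝ} (hA : s.area ≤ B)
    (hB : s.long * s.short ≤ B) :
    s.limit * s.base s.shelves ≤ 48 * √s.count * B := by
  rcases Nat.eq_zero_or_pos s.shelves with h0 | h0
  · have : 0 ≤ B := hs.area_nonneg.trans hA
    rw [h0]
    simp only [base, Finset.range_zero, Finset.sum_empty, mul_zero]
    positivity
  have hH : 0 < s.short := (hs.kind_le 0 h0).1
  have hX := hs.limit_nonneg
  have hW := hs.long_nonneg
  have hA0 := hs.area_nonneg
  have hB0 : 0 ≤ B := hA0.trans hA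
  set K := Int.clog 4 s.short with hK
  have hG : (4 : ℝ) ^ K < 4 * s.short := by
    have := Int.zpow_pred_clog_lt_self (b := 4) (by norm_num) hH
    rw [zpow_sub_one₀ (by norm_num)] at this
    push_cast at this
    rw [hK]
    linarith
  have h4 : ∀ k : ℤ, (4 : ℝ) ^ k = (2 ^ k) ^ 2 := by
    intro k
    rw [← zpow_natCast, ← zpow_mul, mul_comm, zpow_mul]
    norm_num
  have hn := Real.sqrt_nonneg (s.count : ℝ)
  have hn2 := Real.sq_sqrt (Nat.cast_nonneg (α := ℝ) s.count)
  have hkind : ∀ j ∈ Finset.range s.shelves, s.kind j ∈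
      (Finset.range s.shelves).image s.kind := fun j hj => Finset.mem_image_of_mem _ hj
  have hclass : ∀ k ∈ (Finset.range s.shelves).image s.kind,
      s.limit * (s.kindCount k * 4 ^ k) ≤ 24 * √s.count * B * (1 / 2) ^ (K - k).toNat := by
    intro k hk
    obtain ⟨j, hj, rfl⟩ := Finset.mem_image.1 hk
    have hle : s.kind j ≤ K := (hs.kind_le j (Finset.mem_range.1 hj)).2
    set k := s.kind j
    have hpow : (1 / 2 : ℝ) ^ (K - k).toNat * 2 ^ K = 2 ^ k := by
      rw [← zpow_natCast, Int.toNat_of_nonneg (by omega), one_div, inv_zpow',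
        ← zpow_add₀ (by norm_num)]
      congr 1
      ring
    have hk2 : (0 : ℝ) < 2 ^ k := by positivity
    have hK2 : (0 : ℝ) < 2 ^ K := by positivity
    set t : ℝ := ((s.kindCount k - 1 : ℕ) : ℝ) with ht
    have ht0 : 0 ≤ t := Nat.cast_nonneg _
    have hcount : (s.kindCount k : ℝ) ≤ t + 1 := by
      rw [ht]
      exact_mod_cast (by omega : s.kindCount k ≤ s.kindCount k - 1 + 1)
    have hfirst : s.limit * 2 ^ k * 2 ^ K ≤ 12 * √s.count * B := by
      have h2k : (2 : ℝ) ^ k ≤ 2 ^ K := zpow_le_zpow_right₀ (by norm_num) hle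
      have hXn : s.limit ≤ 3 * √s.count * s.long := by
        refine le_of_sq_le_sq ?_ (by positivity)
        have : 0 ≤ (s.count : ℝ) * s.long ^ 2 := by positivity
        rw [mul_pow, mul_pow, hn2]
        linarith [hs.limit_sq_le]
      calc s.limit * 2 ^ k * 2 ^ K ≤ s.limit * 2 ^ K * 2 ^ K := by gcongr
        _ = s.limit * 4 ^ K := by rw [h4]; ring
        _ ≤ (3 * √s.count * s.long) * (4 * s.short) := by gcongr
        _ = 12 * √s.count * (s.long * s.short) := by ring
        _ ≤ _ := by gcongr
    have hrest : s.limit * t * 2 ^ k * 2 ^ K ≤ 12 * √s.count * B := by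
      refine le_of_sq_le_sq ?_ (by positivity)
      calc (s.limit * t * 2 ^ k * 2 ^ K) ^ 2
          = (t ^ 2 * 4 ^ k * s.limit ^ 2) * 4 ^ K := by rw [h4, h4]; ring
        _ ≤ (16 * s.count * (s.long * (s.area + s.long * s.short))) * (4 * s.short) :=
            mul_le_mul (hs.crowd_limit k) hG.le (by positivity) (by positivity)
        _ = 64 * s.count * ((s.long * s.short) * (s.area + s.long * s.short)) := by ring
        _ ≤ 64 * s.count * (B * (B + B)) := by gcongr
        _ ≤ 144 * s.count * (B * B) := by
            have : 0 ≤ (s.count : ℝ) * (B * B) := by positivity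
            linarith
        _ = _ := by rw [mul_pow, mul_pow, hn2]; ring
    calc s.limit * (s.kindCount k * 4 ^ k) ≤ s.limit * ((t + 1) * 4 ^ k) := by gcongr
      _ = (s.limit * t * 2 ^ k * 2 ^ K + s.limit * 2 ^ k * 2 ^ K) * (1 / 2) ^ (K - k).toNat := by
          rw [h4, sq]
          nth_rewrite 2 [← hpow]
          ring
      _ ≤ (12 * √s.count * B + 12 * √s.count * B) * (1 / 2) ^ (K - k).toNat := by gcongr
      _ = _ := by ring
  have hgeom : ∑ k ∈ (Finset.range s.shelves).image s.kind, (1 / 2 : ℝ) ^ (K - k).toNat ≤ 2 := by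
    have hinj : Set.InjOn (fun k : ℤ => (K - k).toNat)
        ((Finset.range s.shelves).image s.kind : Finset ℤ) := by
      have hle : ∀ k ∈ (Finset.range s.shelves).image s.kind, k ≤ K := by
        intro k hk
        obtain ⟨j, hj, rfl⟩ := Finset.mem_image.1 hk
        exact (hs.kind_le j (Finset.mem_range.1 hj)).2
      intro k hk l hl hkl
      have := hle k hk
      have := hle l hl
      simp only at hkl
      omega
    rw [← Finset.sum_image (f := fun i : ℕ => (1 / 2 : ℝ) ^ i) hinj]
    obtain ⟨N, hN⟩ := Finset.exists_nat_subset_range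
      (((Finset.range s.shelves).image s.kind).image fun k : ℤ => (K - k).toNat)
    exact (Finset.sum_le_sum_of_subset_of_nonneg hN fun _ _ _ => by positivity).trans
      (sum_geometric_two_le N)
  calc s.limit * s.base s.shelves
      = ∑ k ∈ (Finset.range s.shelves).image s.kind, s.limit * (s.kindCount k * 4 ^ k) := by
        rw [base, ← Finset.sum_fiberwise_of_maps_to hkind, Finset.mul_sum]
        refine Finset.sum_congr rfl fun k _ => ?_
        congr 1
        rw [kindCount, ← nsmul_eq_mul]
        exact Finset.sum_eq_card_nsmul fun j hj => by rw [(Finset.mem_filter.1 hj).2]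
    _ ≤ ∑ k ∈ (Finset.range s.shelves).image s.kind,
          24 * √s.count * B * (1 / 2) ^ (K - k).toNat := Finset.sum_le_sum hclass
    _ ≤ 24 * √s.count * B * 2 := by
        rw [← Finset.mul_sum]
        exact mul_le_mul_of_nonneg_left hgeom (by positivity)
    _ = _ := by ring

/-- `t` arises from `s` by the arrival of further pieces. -/
structure Extends (s t : ShelfState) : Prop where
  shelves_le : s.shelves ≤ t.shelves
  kind_eq : ∀ j < s.shelves, t.kind j = s.kind j
  len_le : ∀ j, s.len j ≤ t.len j

lemma extends_step (s : ShelfState) (p : Piece) (hp : PiecePos p) : s.Extends (s.step p) :=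
  ⟨s.shelves_le_step p, fun _ hj => s.step_kind_of_lt p hj, s.step_len_le p hp⟩

lemma Extends.base_eq {s t : ShelfState} (h : s.Extends t) {j : ℕ} (hj : j ≤ s.shelves) :
    t.base j = s.base j :=
  Finset.sum_congr rfl fun i hi => by rw [h.kind_eq i ((Finset.mem_range.1 hi).trans_le hj)]

lemma base_nonneg (s : ShelfState) (j : ℕ) : 0 ≤ s.base j :=
  Finset.sum_nonneg fun _ _ => by positivity

lemma base_mono (s : ShelfState) : Monotone s.base := fun _ _ h =>
  Finset.sum_le_sum_of_subset_of_nonneg (Finset.range_mono h) fun _ _ _ => by positivity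

/-- The state after the stream `L`. -/
noncomputable def run (L : List Piece) : ShelfState := L.foldl step start

lemma run_append (L : List Piece) (p : Piece) : run (L ++ [p]) = (run L).step p := by
  simp [run]

lemma run_inv (L : List Piece) (hL : ∀ p ∈ L, PiecePos p) : (run L).Inv := by
  induction L using List.reverseRecOn with
  | nil => exact inv_start
  | append_singleton L p ih =>
    rw [run_append]
    exact inv_step _ (ih fun q hq => hL q (by simp [hq])) p (hL p (by simp))

lemma run_extends (L M : List Piece) (hM : ∀ p ∈ M, PiecePos p) :
    (run L).Extends (run (L ++ M)) := by
  induction M using List.reverseRecOn with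
  | nil => simpa using ⟨le_rfl, fun _ _ => rfl, fun _ => le_rfl⟩
  | append_singleton M p ih =>
    obtain ⟨h1, h2, h3⟩ := ih fun q hq => hM q (by simp [hq])
    obtain ⟨g1, g2, g3⟩ := extends_step (run (L ++ M)) p (hM p (by simp))
    rw [← List.append_assoc, run_append]
    exact ⟨h1.trans g1, fun j hj => (g2 j (hj.trans_le h1)).trans (h2 j hj),
      fun j => (h3 j).trans (g3 j)⟩

lemma run_extends_of_prefix {L M : List Piece} (h : L <+: M) (hM : ∀ p ∈ M, PiecePos p) :
    (run L).Extends (run M) := by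
  obtain ⟨N, rfl⟩ := h
  exact run_extends L N fun p hp => hM p (by simp [hp])

lemma run_count (L : List Piece) : (run L).count = L.length := by
  induction L using List.reverseRecOn with
  | nil => rfl
  | append_singleton L p ih => rw [run_append]; simp [step, ih]

lemma run_area (L : List Piece) : (run L).area = (L.map fun p => p.1 * p.2).sum := by
  induction L using List.reverseRecOn with
  | nil => rfl
  | append_singleton L p ih => rw [run_append]; simp [step, ih]

lemma exists_long_eq (L : List Piece) (hne : L ≠ []) (hL : ∀ p ∈ L, PiecePos p) :
    ∃ p ∈ L, (run L).long = max p.1 p.2 := by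
  induction L using List.reverseRecOn with
  | nil => exact absurd rfl hne
  | append_singleton L p ih =>
    have hp := hL p (by simp)
    rw [run_append]
    change ∃ q ∈ L ++ [p], max (run L).long (max p.1 p.2) = max q.1 q.2
    rcases le_total (run L).long (max p.1 p.2) with h | h
    · exact ⟨p, by simp, max_eq_right h⟩
    · have hLne : L ≠ [] := by
        rintro rfl
        exact absurd h (not_le.2 (lt_max_of_lt_left hp.1))
      obtain ⟨q, hq, hqe⟩ := ih hLne fun q hq => hL q (by simp [hq])
      exact ⟨q, by simp [hq], (max_eq_left h).trans hqe⟩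

lemma exists_short_eq (L : List Piece) (hne : L ≠ []) (hL : ∀ p ∈ L, PiecePos p) :
    ∃ p ∈ L, (run L).short = min p.1 p.2 := by
  induction L using List.reverseRecOn with
  | nil => exact absurd rfl hne
  | append_singleton L p ih =>
    have hp := hL p (by simp)
    rw [run_append]
    change ∃ q ∈ L ++ [p], max (run L).short (min p.1 p.2) = min q.1 q.2
    rcases le_total (run L).short (min p.1 p.2) with h | h
    · exact ⟨p, by simp, max_eq_right h⟩
    · have hLne : L ≠ [] := by
        rintro rfl
        exact absurd h (not_le.2 (lt_min hp.1 hp.2))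
      obtain ⟨q, hq, hqe⟩ := ih hLne fun q hq => hL q (by simp [hq])
      exact ⟨q, by simp [hq], (max_eq_left h).trans hqe⟩

end ShelfState

open ShelfState

/-- The shelf strategy. -/
noncomputable def shelfStrategy (L : List Piece) : (ℝ × ℝ) × Bool := (run L).last

lemma orient_decide (p : Piece) : orient p (decide (p.1 < p.2)) = (max p.1 p.2, min p.1 p.2) := by
  unfold orient
  by_cases h : p.1 < p.2
  · simp [h, h.le]
  · have h := not_lt.1 h
    simp [h]

lemma take_pos {L : List Piece} (hL : ∀ p ∈ L, PiecePos p) (i : ℕ) :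
    ∀ p ∈ L.take i, PiecePos p := fun p hp => hL p (List.mem_of_mem_take hp)

/-- The data of the placement of the `i`-th piece: it lies on shelf `j`, between the shelf lengths
before and after its arrival. -/
lemma exists_shelf (L : List Piece) (hL : ∀ p ∈ L, PiecePos p) (i : Fin L.length) :
    ∃ j, j < (run (L.take (i + 1))).shelves ∧
      (onlineRotPos shelfStrategy L i).1 = (run (L.take i)).len j ∧
      (onlineRotPos shelfStrategy L i).1 + (orient (L.get i) (onlineRot shelfStrategy L i)).1 =
        (run (L.take (i + 1))).len j ∧
      (onlineRotPos shelfStrategy L i).2 = (run L).base j ∧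
      (onlineRotPos shelfStrategy L i).2 + (orient (L.get i) (onlineRot shelfStrategy L i)).2 ≤
        (run L).base (j + 1) := by
  have hstep : run (L.take (i + 1)) = (run (L.take i)).step (L.get i) := by
    rw [List.take_succ_eq_append_getElem i.2, run_append]
    rfl
  set s := run (L.take i) with hs
  set p := L.get i with hp
  have hpos : onlineRotPos shelfStrategy L i = (s.len (s.nextShelf p), s.base (s.nextShelf p)) := by
    simp only [onlineRotPos, shelfStrategy, hstep]
    rfl
  have hrot : onlineRot shelfStrategy L i = decide (p.1 < p.2) := by
    simp only [onlineRot, shelfStrategy, hstep]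
    rfl
  have hext : s.Extends (run L) := run_extends_of_prefix (List.take_prefix _ _) hL
  have hext' : (s.step p).Extends (run L) := hstep ▸ run_extends_of_prefix (List.take_prefix _ _) hL
  have hbase := hext.base_eq (s.nextShelf_le p)
  rw [hstep, hpos, hrot, orient_decide]
  refine ⟨s.nextShelf p, s.nextShelf_lt_step p, rfl, (s.step_len_cur p).symm, hbase.symm, ?_⟩
  have hb : (run L).base (s.nextShelf p + 1) =
      (run L).base (s.nextShelf p) + 4 ^ (run L).kind (s.nextShelf p) := Finset.sum_range_succ _ _
  rw [hb, hbase, hext'.kind_eq _ (s.nextShelf_lt_step p), step_kind_cur]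
  have := Int.self_le_zpow_clog (b := 4) (by norm_num) (min p.1 p.2)
  push_cast at this
  simpa using this

lemma disjoint_interior_placedRect {p q : Piece} {a b : ℝ × ℝ}
    (h : a.1 + p.1 ≤ b.1 ∨ b.1 + q.1 ≤ a.1 ∨ a.2 + p.2 ≤ b.2 ∨ b.2 + q.2 ≤ a.2) :
    Disjoint (interior (placedRect p a)) (interior (placedRect q b)) := by
  simp only [placedRect, interior_prod_eq, interior_Icc]
  rw [Set.disjoint_left]
  rintro x ⟨⟨h1, h2⟩, h3, h4⟩ ⟨⟨h5, h6⟩, h7, h8⟩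
  rcases h with h | h | h | h <;> linarith

lemma shelfStrategy_disjoint (L : List Piece) (hL : ∀ p ∈ L, PiecePos p) {i j : Fin L.length}
    (hij : i < j) :
    Disjoint
      (interior (placedRect (orient (L.get i) (onlineRot shelfStrategy L i))
        (onlineRotPos shelfStrategy L i)))
      (interior (placedRect (orient (L.get j) (onlineRot shelfStrategy L j))
        (onlineRotPos shelfStrategy L j))) := by
  obtain ⟨a, ha1, ha2, ha3, ha4, ha5⟩ := exists_shelf L hL i
  obtain ⟨b, hb1, hb2, hb3, hb4, hb5⟩ := exists_shelf L hL j
  apply disjoint_interior_placedRect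
  rcases lt_trichotomy a b with hab | rfl | hab
  · right; right; left
    rw [hb4]
    exact ha5.trans ((run L).base_mono hab)
  · left
    rw [ha3, hb2]
    exact (run_extends_of_prefix (List.take_prefix_take_left (by simpa using hij))
      (take_pos hL _)).len_le a
  · right; right; right
    rw [ha4]
    exact hb5.trans ((run L).base_mono hab)

lemma shelfStrategy_valid : RotStrategyValid shelfStrategy := by
  intro L hL i j hij
  rcases lt_or_gt_of_ne hij with h | h
  · exact shelfStrategy_disjoint L hL h
  · exact (shelfStrategy_disjoint L hL h).symm

lemma shelfStrategy_subset (L : List Piece) (hL : ∀ p ∈ L, PiecePos p) :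
    packedRotSet L (onlineRotPos shelfStrategy L) (onlineRot shelfStrategy L) ⊆
      Set.Icc 0 (run L).limit ×ˢ Set.Icc 0 ((run L).base (run L).shelves) := by
  refine Set.iUnion_subset fun i => ?_
  obtain ⟨a, ha1, ha2, ha3, ha4, ha5⟩ := exists_shelf L hL i
  have hext := run_extends_of_prefix (List.take_prefix ((i : ℕ) + 1) L) hL
  have hlen := (hext.len_le a).trans ((run_inv L hL).len_le a)
  have h0 := (run_inv (L.take i) (take_pos hL _)).len_nonneg a
  have hb := (run L).base_nonneg a
  have hb' := (run L).base_mono (Nat.succ_le_of_lt (ha1.trans_le hext.shelves_le))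
  rintro x ⟨⟨h1, h2⟩, h3, h4⟩
  refine ⟨⟨?_, ?_⟩, ?_, ?_⟩
  · linarith
  · linarith
  · linarith
  · exact (h4.trans ha5).trans hb'

lemma boxWidth_le {S : Set (ℝ × ℝ)} {X Y : ℝ} (hS : S.Nonempty)
    (h : S ⊆ Set.Icc 0 X ×ˢ Set.Icc 0 Y) : boxWidth S ≤ X := by
  have h1 : sSup (Prod.fst '' S) ≤ X :=
    csSup_le (hS.image _) (by rintro _ ⟨x, hx, rfl⟩; exact (h hx).1.2)
  have h2 : 0 ≤ sInf (Prod.fst '' S) :=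
    le_csInf (hS.image _) (by rintro _ ⟨x, hx, rfl⟩; exact (h hx).1.1)
  unfold boxWidth
  linarith

lemma boxHeight_le {S : Set (ℝ × ℝ)} {X Y : ℝ} (hS : S.Nonempty)
    (h : S ⊆ Set.Icc 0 X ×ˢ Set.Icc 0 Y) : boxHeight S ≤ Y := by
  have h1 : sSup (Prod.snd '' S) ≤ Y :=
    csSup_le (hS.image _) (by rintro _ ⟨x, hx, rfl⟩; exact (h hx).2.2)
  have h2 : 0 ≤ sInf (Prod.snd '' S) :=
    le_csInf (hS.image _) (by rintro _ ⟨x, hx, rfl⟩; exact (h hx).2.1)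
  unfold boxHeight
  linarith

/-- A bounded set lies in its bounding box. -/
lemma subset_box {S : Set (ℝ × ℝ)} (hS : Bornology.IsBounded S) :
    S ⊆ Set.Icc (sInf (Prod.fst '' S)) (sSup (Prod.fst '' S)) ×ˢ
      Set.Icc (sInf (Prod.snd '' S)) (sSup (Prod.snd '' S)) := by
  obtain ⟨h1, h2⟩ := isBounded_iff_bddBelow_bddAbove.1 hS.image_fst
  obtain ⟨h3, h4⟩ := isBounded_iff_bddBelow_bddAbove.1 hS.image_snd
  exact fun x hx => ⟨⟨csInf_le h1 ⟨x, hx, rfl⟩, le_csSup h2 ⟨x, hx, rfl⟩⟩,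
    csInf_le h3 ⟨x, hx, rfl⟩, le_csSup h4 ⟨x, hx, rfl⟩⟩

lemma isBounded_placedRect (p : Piece) (q : ℝ × ℝ) : Bornology.IsBounded (placedRect p q) :=
  (Metric.isBounded_Icc _ _).prod (Metric.isBounded_Icc _ _)

lemma isBounded_packedRotSet (L : List Piece) (pos : Fin L.length → ℝ × ℝ)
    (rot : Fin L.length → Bool) : Bornology.IsBounded (packedRotSet L pos rot) :=
  Bornology.isBounded_iUnion.2 fun _ => isBounded_placedRect _ _

lemma orient_pos {p : Piece} (hp : PiecePos p) (r : Bool) : PiecePos (orient p r) := by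
  cases r
  · exact hp
  · exact ⟨hp.2, hp.1⟩

/-- The bounding box of a packing is at least as large as each of the placed pieces. -/
lemma orient_le_box {L : List Piece} (hL : ∀ p ∈ L, PiecePos p) (pos : Fin L.length → ℝ × ℝ)
    (rot : Fin L.length → Bool) (i : Fin L.length) :
    (orient (L.get i) (rot i)).1 ≤ boxWidth (packedRotSet L pos rot) ∧
      (orient (L.get i) (rot i)).2 ≤ boxHeight (packedRotSet L pos rot) := by
  obtain ⟨hp1, hp2⟩ := orient_pos (hL _ (List.get_mem L i)) (rot i)
  have hsub := (Set.subset_iUnion (fun i => placedRect (orient (L.get i) (rot i)) (pos i)) i).trans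
    (subset_box (isBounded_packedRotSet L pos rot))
  have h1 := hsub (show pos i ∈ _ from ⟨⟨le_rfl, by linarith⟩, le_rfl, by linarith⟩)
  have h2 := hsub (show ((pos i).1 + (orient (L.get i) (rot i)).1,
    (pos i).2 + (orient (L.get i) (rot i)).2) ∈ _ from
    ⟨⟨by simpa using hp1.le, le_rfl⟩, by simpa using hp2.le, le_rfl⟩)
  constructor
  · have h3 := h1.1.1
    have h4 : (pos i).1 + (orient (L.get i) (rot i)).1 ≤ _ := h2.1.2
    unfold boxWidth packedRotSet
    linarith
  · have h3 := h1.2.1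
    have h4 : (pos i).2 + (orient (L.get i) (rot i)).2 ≤ _ := h2.2.2
    unfold boxHeight packedRotSet
    linarith

lemma sum_area_le_areaRotCost {L : List Piece} (hL : ∀ p ∈ L, PiecePos p)
    (hne : L ≠ []) {pos : Fin L.length → ℝ × ℝ} {rot : Fin L.length → Bool}
    (h : IsRotPacking L pos rot) :
    (L.map fun p => p.1 * p.2).sum ≤ areaRotCost L pos rot := by
  have hvol : ∀ i, MeasureTheory.volume (interior (placedRect (orient (L.get i) (rot i)) (pos i))) =
      ENNReal.ofReal ((L.get i).1 * (L.get i).2) := by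
    intro i
    have hp := orient_pos (hL _ (List.get_mem L i)) (rot i)
    simp only [placedRect, interior_prod_eq, interior_Icc]
    rw [MeasureTheory.Measure.volume_eq_prod, MeasureTheory.Measure.prod_prod, Real.volume_Ioo,
      Real.volume_Ioo, add_sub_cancel_left, add_sub_cancel_left, ← ENNReal.ofReal_mul hp.1.le]
    congr 1
    cases rot i
    · rfl
    · exact mul_comm _ _
  have i₀ : Fin L.length := ⟨0, List.length_pos_iff.2 hne⟩
  have hbox := orient_le_box hL pos rot i₀
  have hp := orient_pos (hL _ (List.get_mem L i₀)) (rot i₀)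
  have hsub : (⋃ i, interior (placedRect (orient (L.get i) (rot i)) (pos i))) ⊆ _ :=
    (Set.iUnion_mono fun i => interior_subset).trans (subset_box (isBounded_packedRotSet L pos rot))
  have hle := MeasureTheory.measure_mono (μ := MeasureTheory.volume) hsub
  rw [MeasureTheory.measure_iUnion (fun i j hij => h i j hij)
    (fun i => isOpen_interior.measurableSet), tsum_fintype,
    Finset.sum_congr rfl fun i _ => hvol i, MeasureTheory.Measure.volume_eq_prod,
    MeasureTheory.Measure.prod_prod, Real.volume_Icc, Real.volume_Icc] at hle
  change _ ≤ ENNReal.ofReal (boxWidth (packedRotSet L pos rot)) *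
    ENNReal.ofReal (boxHeight (packedRotSet L pos rot)) at hle
  rw [← ENNReal.ofReal_mul (hp.1.le.trans hbox.1),
    ← ENNReal.ofReal_sum_of_nonneg fun i _ =>
      (mul_pos (hL _ (List.get_mem L i)).1 (hL _ (List.get_mem L i)).2).le,
    ENNReal.ofReal_le_ofReal_iff
      (mul_nonneg (hp.1.le.trans hbox.1) (hp.2.le.trans hbox.2))] at hle
  refine le_trans (le_of_eq ?_) hle
  rw [← Fin.sum_univ_fun_getElem]
  rfl

lemma long_mul_short_le_areaRotCost {L : List Piece} (hL : ∀ p ∈ L, PiecePos p)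
    (pos : Fin L.length → ℝ × ℝ) (rot : Fin L.length → Bool) {p q : Piece} (hp : p ∈ L)
    (hq : q ∈ L) : max p.1 p.2 * min q.1 q.2 ≤ areaRotCost L pos rot := by
  obtain ⟨i, rfl⟩ := List.get_of_mem hp
  obtain ⟨j, rfl⟩ := List.get_of_mem hq
  obtain ⟨hi1, hi2⟩ := orient_le_box hL pos rot i
  obtain ⟨hj1, hj2⟩ := orient_le_box hL pos rot j
  have hposi := hL _ (List.get_mem L i)
  have hposj := hL _ (List.get_mem L j)
  have hlong : max (L.get i).1 (L.get i).2 ≤ boxWidth (packedRotSet L pos rot) ∨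
      max (L.get i).1 (L.get i).2 ≤ boxHeight (packedRotSet L pos rot) := by
    rcases max_choice (L.get i).1 (L.get i).2 with h | h <;> rw [h] <;>
      cases hr : rot i <;> simp only [hr, orient] at hi1 hi2 <;> tauto
  have hmin1 : min (L.get j).1 (L.get j).2 ≤ (orient (L.get j) (rot j)).1 := by
    cases rot j
    · exact min_le_left _ _
    · exact min_le_right _ _
  have hmin2 : min (L.get j).1 (L.get j).2 ≤ (orient (L.get j) (rot j)).2 := by
    cases rot j
    · exact min_le_right _ _
    · exact min_le_left _ _
  have hmin0 : 0 < min (L.get j).1 (L.get j).2 := lt_min hposj.1 hposj.2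
  have hmax0 : 0 < max (L.get i).1 (L.get i).2 := lt_max_of_lt_left hposi.1
  unfold areaRotCost
  rcases hlong with h | h
  · exact mul_le_mul h (hmin2.trans hj2) hmin0.le (hmax0.le.trans h)
  · rw [mul_comm]
    exact mul_le_mul (hmin1.trans hj1) h hmax0.le (hmin0.le.trans (hmin1.trans hj1))

lemma le_optRotArea {L : List Piece} (hL : ∀ p ∈ L, PiecePos p) {c : ℝ}
    (h : ∀ pos rot, IsRotPacking L pos rot → c ≤ areaRotCost L pos rot) : c ≤ optRotArea L := by
  refine le_csInf ⟨_, _, _, shelfStrategy_valid L hL, rfl⟩ ?_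
  rintro _ ⟨pos, rot, hpack, rfl⟩
  exact h pos rot hpack

/-- There exist a constant `C > 0` and a valid online rotation
strategy `σ` such that for every nonempty finite stream `L` of `n` pieces,
`ALG_σ(L) ≤ C * √n * OPT(L)` (area of the bounding box, rotations by 90°
allowed). -/
theorem area_rotation_sqrt_n_upper_bound :
    ∃ C : ℝ, 0 < C ∧ ∃ σ : List Piece → (ℝ × ℝ) × Bool, RotStrategyValid σ ∧
      ∀ L : List Piece, L ≠ [] → (∀ p ∈ L, PiecePos p) →
        algRotArea σ L ≤ C * Real.sqrt (L.length) * optRotArea L := by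
  refine ⟨48, by norm_num, shelfStrategy, shelfStrategy_valid, fun L hne hL => ?_⟩
  have hsub := shelfStrategy_subset L hL
  have hinv := run_inv L hL
  have i₀ : Fin L.length := ⟨0, List.length_pos_iff.2 hne⟩
  have hbox := orient_le_box hL (onlineRotPos shelfStrategy L) (onlineRot shelfStrategy L) i₀
  have hi₀ := orient_pos (hL _ (List.get_mem L i₀)) (onlineRot shelfStrategy L i₀)
  have hS : (packedRotSet L (onlineRotPos shelfStrategy L) (onlineRot shelfStrategy L)).Nonempty :=
    ⟨onlineRotPos shelfStrategy L i₀, Set.mem_iUnion.2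
      ⟨i₀, ⟨le_rfl, le_add_of_nonneg_right hi₀.1.le⟩, le_rfl, le_add_of_nonneg_right hi₀.2.le⟩⟩
  have hA : (run L).area ≤ optRotArea L := by
    rw [run_area]
    exact le_optRotArea hL fun _ _ h => sum_area_le_areaRotCost hL hne h
  have hB : (run L).long * (run L).short ≤ optRotArea L := by
    obtain ⟨p, hp, hpe⟩ := exists_long_eq L hne hL
    obtain ⟨q, hq, hqe⟩ := exists_short_eq L hne hL
    rw [hpe, hqe]
    exact le_optRotArea hL fun pos rot _ => long_mul_short_le_areaRotCost hL pos rot hp hq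
  rw [← run_count L]
  exact (mul_le_mul (boxWidth_le hS hsub) (boxHeight_le hS hsub) (hi₀.2.le.trans hbox.2)
    hinv.limit_nonneg).trans (hinv.limit_mul_base_le hA hB)
end

section
/- For every valid online translation strategy σ for streams of square pieces, there exists a nonempty finite stream L of square pieces such that ALG_σ(L) ≥ (16/9)·OPT(L), where the cost of a packing is the area of the smallest axis-parallel square containing all placed squares. (Lower bound of 16/9 for online packing of squares into a minimum-area bounding square.) -/
open Set

/-- Two axis-parallel squares of sides `s` and `t` at `p` and `q` are separated by a vertical or
a horizontal line. -/
def Separated (s : ℝ) (p : ℝ × ℝ) (t : ℝ) (q : ℝ × ℝ) : Prop :=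
  p.1 + s ≤ q.1 ∨ q.1 + t ≤ p.1 ∨ p.2 + s ≤ q.2 ∨ q.2 + t ≤ p.2

lemma interior_placedSq (s : ℝ) (p : ℝ × ℝ) :
    interior (placedSq s p) = Ioo p.1 (p.1 + s) ×ˢ Ioo p.2 (p.2 + s) := by
  rw [placedSq, interior_prod_eq, interior_Icc, interior_Icc]

lemma disjoint_interior_placedSq_iff {s t : ℝ} (hs : 0 < s) (ht : 0 < t) (p q : ℝ × ℝ) :
    Disjoint (interior (placedSq s p)) (interior (placedSq t q)) ↔ Separated s p t q := by
  simp only [interior_placedSq, disjoint_prod, Ioo_disjoint_Ioo, min_le_iff, le_max_iff, Separated]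
  grind

lemma packedSqSet_subset {L : List ℝ} {pos : Fin L.length → ℝ × ℝ} {a b c d : ℝ}
    (h : ∀ i, a ≤ (pos i).1 ∧ (pos i).1 + L.get i ≤ b ∧ c ≤ (pos i).2 ∧ (pos i).2 + L.get i ≤ d) :
    packedSqSet L pos ⊆ Icc a b ×ˢ Icc c d := by
  refine iUnion_subset fun i => prod_mono ?_ ?_
  · exact Icc_subset_Icc (h i).1 (h i).2.1
  · exact Icc_subset_Icc (h i).2.2.1 (h i).2.2.2

lemma isBounded_packedSqSet (L : List ℝ) (pos : Fin L.length → ℝ × ℝ) :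
    Bornology.IsBounded (packedSqSet L pos) :=
  Bornology.isBounded_iUnion.2 fun _ => (Metric.isBounded_Icc _ _).prod (Metric.isBounded_Icc _ _)

lemma csSup_sub_csInf_le {S : Set ℝ} (hS : S.Nonempty) {a b : ℝ} (h : S ⊆ Icc a b) :
    sSup S - sInf S ≤ b - a :=
  sub_le_sub (csSup_le hS fun _ hx => (h hx).2) (le_csInf hS fun _ hx => (h hx).1)

lemma sub_le_csSup_sub_csInf {S : Set ℝ} (hS : Bornology.IsBounded S) {x y : ℝ}
    (hx : x ∈ S) (hy : y ∈ S) : y - x ≤ sSup S - sInf S :=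
  sub_le_sub (le_csSup hS.bddAbove hy) (csInf_le hS.bddBelow hx)

lemma sub_le_boxWidth {S : Set (ℝ × ℝ)} (hS : Bornology.IsBounded S) {x y : ℝ × ℝ}
    (hx : x ∈ S) (hy : y ∈ S) : y.1 - x.1 ≤ boxWidth S :=
  sub_le_csSup_sub_csInf hS.image_fst (mem_image_of_mem _ hx) (mem_image_of_mem _ hy)

lemma sub_le_boxHeight {S : Set (ℝ × ℝ)} (hS : Bornology.IsBounded S) {x y : ℝ × ℝ}
    (hx : x ∈ S) (hy : y ∈ S) : y.2 - x.2 ≤ boxHeight S :=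
  sub_le_csSup_sub_csInf hS.image_snd (mem_image_of_mem _ hx) (mem_image_of_mem _ hy)

lemma lower_corner_mem_packedSqSet {L : List ℝ} (hL : ∀ s ∈ L, 0 < s)
    (pos : Fin L.length → ℝ × ℝ) (i : Fin L.length) : pos i ∈ packedSqSet L pos := by
  have := hL _ (L.get_mem i)
  exact mem_iUnion.2 ⟨i, ⟨le_rfl, by linarith⟩, ⟨le_rfl, by linarith⟩⟩

lemma upper_corner_mem_packedSqSet {L : List ℝ} (hL : ∀ s ∈ L, 0 < s)
    (pos : Fin L.length → ℝ × ℝ) (i : Fin L.length) :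
    ((pos i).1 + L.get i, (pos i).2 + L.get i) ∈ packedSqSet L pos := by
  have := hL _ (L.get_mem i)
  exact mem_iUnion.2 ⟨i, ⟨by linarith, le_rfl⟩, ⟨by linarith, le_rfl⟩⟩

/-- If the cost is less than `c ^ 2`, all horizontal and vertical extents are less than `c`. -/
lemma extent_lt_of_sqCost_lt {L : List ℝ} (hL : ∀ s ∈ L, 0 < s) {pos : Fin L.length → ℝ × ℝ}
    {c : ℝ} (hc : 0 ≤ c) (h : sqCost L pos < c ^ 2) (i j : Fin L.length) :
    (pos j).1 + L.get j - (pos i).1 < c ∧ (pos j).2 + L.get j - (pos i).2 < c := by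
  have hb := isBounded_packedSqSet L pos
  have hi := lower_corner_mem_packedSqSet hL pos i
  have hj := upper_corner_mem_packedSqSet hL pos j
  have hlt := max_lt_iff.1 (lt_of_pow_lt_pow_left₀ 2 hc h)
  exact ⟨(sub_le_boxWidth hb hi hj).trans_lt hlt.1, (sub_le_boxHeight hb hi hj).trans_lt hlt.2⟩

/-- A packing inside the square `[0, c] ^ 2` bounds the optimal cost by `c ^ 2`. -/
lemma optSq_le {L : List ℝ} (hne : L ≠ []) (hL : ∀ s ∈ L, 0 < s) (pos : Fin L.length → ℝ × ℝ)
    (hpos : ∀ i j, i ≠ j → Separated (L.get i) (pos i) (L.get j) (pos j)) {c : ℝ}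
    (h : ∀ i, 0 ≤ (pos i).1 ∧ (pos i).1 + L.get i ≤ c ∧ 0 ≤ (pos i).2 ∧ (pos i).2 + L.get i ≤ c) :
    optSq L ≤ c ^ 2 := by
  have hpack : IsSqPacking L pos := fun i j hij =>
    (disjoint_interior_placedSq_iff (hL _ (L.get_mem i)) (hL _ (L.get_mem j)) _ _).2 (hpos i j hij)
  have hmem := lower_corner_mem_packedSqSet hL pos ⟨0, List.length_pos_iff.2 hne⟩
  have hsub := packedSqSet_subset h
  have hw : boxWidth (packedSqSet L pos) ≤ c - 0 :=
    csSup_sub_csInf_le ⟨_, mem_image_of_mem _ hmem⟩ (image_subset_iff.2 fun _ hx => (hsub hx).1)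
  have hh : boxHeight (packedSqSet L pos) ≤ c - 0 :=
    csSup_sub_csInf_le ⟨_, mem_image_of_mem _ hmem⟩ (image_subset_iff.2 fun _ hx => (hsub hx).2)
  have h0 : 0 ≤ boxWidth (packedSqSet L pos) := by
    simpa using sub_le_boxWidth (isBounded_packedSqSet L pos) hmem hmem
  rw [sub_zero] at hw hh
  calc optSq L ≤ sqCost L pos :=
        csInf_le ⟨0, by rintro _ ⟨_, _, rfl⟩; exact sq_nonneg _⟩ ⟨pos, hpack, rfl⟩
    _ ≤ c ^ 2 := pow_le_pow_left₀ (h0.trans (le_max_left _ _)) (max_le hw hh) 2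

/-- Four pairwise separated unit squares in a square of side less than `3` form a `2 × 2`
pattern. -/
lemma exists_two_by_two_pattern (P : Fin 4 → ℝ × ℝ)
    (hsep : ∀ i j, i ≠ j → Separated 1 (P i) 1 (P j))
    (hext : ∀ i j, (P j).1 + 1 - (P i).1 < 3 ∧ (P j).2 + 1 - (P i).2 < 3) :
    ∃ sw se nw ne, (P sw).1 + 1 ≤ (P se).1 ∧ (P nw).1 + 1 ≤ (P ne).1 ∧
      (P sw).2 + 1 ≤ (P nw).2 ∧ (P se).2 + 1 ≤ (P ne).2 := by
  classical
  let east (i : Fin 4) : Prop := ∃ j, (P j).1 + 1 ≤ (P i).1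
  let north (i : Fin 4) : Prop := ∃ j, (P j).2 + 1 ≤ (P i).2
  have east_of_le {i j} (h : (P i).1 + 1 ≤ (P j).1) : east j ∧ ¬ east i :=
    ⟨⟨i, h⟩, fun ⟨k, hk⟩ => by linarith [(hext k j).1]⟩
  have north_of_le {i j} (h : (P i).2 + 1 ≤ (P j).2) : north j ∧ ¬ north i :=
    ⟨⟨i, h⟩, fun ⟨k, hk⟩ => by linarith [(hext k j).2]⟩
  let f (i : Fin 4) : Bool × Bool := (decide (east i), decide (north i))
  have hinj : Function.Injective f := by
    intro i j hij
    by_contra hne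
    have he : east i ↔ east j := decide_eq_decide.1 (Prod.ext_iff.1 hij).1
    have hn : north i ↔ north j := decide_eq_decide.1 (Prod.ext_iff.1 hij).2
    rcases hsep i j hne with h | h | h | h
    · exact (east_of_le h).2 (he.2 (east_of_le h).1)
    · exact (east_of_le h).2 (he.1 (east_of_le h).1)
    · exact (north_of_le h).2 (hn.2 (north_of_le h).1)
    · exact (north_of_le h).2 (hn.1 (north_of_le h).1)
  have hsurj : Function.Surjective f :=
    ((Fintype.bijective_iff_injective_and_card f).2 ⟨hinj, by simp⟩).surjective
  have horizontal {i j} (hi : ¬ east i) (hj : east j) (h : north i ↔ north j) :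
      (P i).1 + 1 ≤ (P j).1 := by
    rcases hsep i j (by rintro rfl; exact hi hj) with h' | h' | h' | h'
    · exact h'
    · exact absurd (east_of_le h').1 hi
    · exact absurd (h.2 (north_of_le h').1) (north_of_le h').2
    · exact absurd (h.1 (north_of_le h').1) (north_of_le h').2
  have vertical {i j} (hi : ¬ north i) (hj : north j) (h : east i ↔ east j) :
      (P i).2 + 1 ≤ (P j).2 := by
    rcases hsep i j (by rintro rfl; exact hi hj) with h' | h' | h' | h'
    · exact absurd (h.2 (east_of_le h').1) (east_of_le h').2
    · exact absurd (h.1 (east_of_le h').1) (east_of_le h').2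
    · exact h'
    · exact absurd (north_of_le h').1 hi
  obtain ⟨sw, hsw⟩ := hsurj (false, false)
  obtain ⟨se, hse⟩ := hsurj (true, false)
  obtain ⟨nw, hnw⟩ := hsurj (false, true)
  obtain ⟨ne, hne⟩ := hsurj (true, true)
  simp only [f, Prod.mk.injEq, decide_eq_true_eq, decide_eq_false_iff_not] at hsw hse hnw hne
  exact ⟨sw, se, nw, ne,
    horizontal hsw.1 hse.1 (iff_of_false hsw.2 hse.2),
    horizontal hnw.1 hne.1 (iff_of_true hnw.2 hne.2),
    vertical hsw.2 hnw.2 (iff_of_false hsw.1 hnw.1),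
    vertical hse.2 hne.2 (iff_of_true hse.1 hne.1)⟩

/-- Four unit squares packed in a square of side less than `3` cannot be completed by a square of
side `2` within a square of side less than `4`. -/
lemma no_square_of_side_two (P : Fin 4 → ℝ × ℝ) (q : ℝ × ℝ)
    (hsep : ∀ i j, i ≠ j → Separated 1 (P i) 1 (P j))
    (hext : ∀ i j, (P j).1 + 1 - (P i).1 < 3 ∧ (P j).2 + 1 - (P i).2 < 3)
    (hq : ∀ i, Separated 1 (P i) 2 q)
    (hlow : ∀ i, (P i).1 + 1 - q.1 < 4 ∧ (P i).2 + 1 - q.2 < 4)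
    (hupp : ∀ i, q.1 + 2 - (P i).1 < 4 ∧ q.2 + 2 - (P i).2 < 4) : False := by
  obtain ⟨sw, se, nw, ne, h₁, h₂, h₃, h₄⟩ := exists_two_by_two_pattern P hsep hext
  have hsw : (P sw).1 + 1 ≤ q.1 ∨ (P sw).2 + 1 ≤ q.2 := by
    rcases hq sw with h | h | h | h
    · exact .inl h
    · linarith [(hlow se).1]
    · exact .inr h
    · linarith [(hlow nw).2]
  have hse : q.1 + 2 ≤ (P se).1 ∨ (P se).2 + 1 ≤ q.2 := by
    rcases hq se with h | h | h | h
    · linarith [(hupp sw).1]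
    · exact .inl h
    · exact .inr h
    · linarith [(hlow ne).2]
  have hnw : (P nw).1 + 1 ≤ q.1 ∨ q.2 + 2 ≤ (P nw).2 := by
    rcases hq nw with h | h | h | h
    · exact .inl h
    · linarith [(hlow ne).1]
    · linarith [(hupp sw).2]
    · exact .inr h
  have hne : q.1 + 2 ≤ (P ne).1 ∨ q.2 + 2 ≤ (P ne).2 := by
    rcases hq ne with h | h | h | h
    · linarith [(hupp nw).1]
    · exact .inl h
    · linarith [(hupp se).2]
    · exact .inr h
  have hx (i j) (hi : (P i).1 + 1 ≤ q.1) (hj : q.1 + 2 ≤ (P j).1) : False := by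
    linarith [(hext i j).1]
  have hy (i j) (hi : (P i).2 + 1 ≤ q.2) (hj : q.2 + 2 ≤ (P j).2) : False := by
    linarith [(hext i j).2]
  grind

lemma optSq_four_unit_squares_le : optSq [1, 1, 1, 1] ≤ 2 ^ 2 := by
  refine optSq_le (by simp) (by simp) ![(0, 0), (1, 0), (0, 1), (1, 1)] ?_ ?_
  · intro i j hij
    fin_cases i <;> fin_cases j <;> simp [Separated] at hij ⊢
  · intro i
    fin_cases i <;> norm_num

lemma optSq_four_unit_squares_and_two_le : optSq [1, 1, 1, 1, 2] ≤ 3 ^ 2 := by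
  refine optSq_le (by simp) (by simp) ![(2, 0), (2, 1), (0, 2), (1, 2), (0, 0)] ?_ ?_
  · intro i j hij
    fin_cases i <;> fin_cases j <;> simp [Separated] at hij ⊢ <;> norm_num
  · intro i
    fin_cases i <;> norm_num

/-- A valid strategy keeps every two placed squares separated. -/
lemma SqStrategyValid.separated {σ : List ℝ → ℝ × ℝ} (hσ : SqStrategyValid σ) {L : List ℝ}
    (hL : ∀ s ∈ L, 0 < s) {i j : Fin L.length} (hij : i ≠ j) :
    Separated (L.get i) (onlineSqPos σ L i) (L.get j) (onlineSqPos σ L j) :=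
  (disjoint_interior_placedSq_iff (hL _ (L.get_mem i)) (hL _ (L.get_mem j)) _ _).1
    (hσ L hL i j hij)

/-- For every valid online translation strategy `σ` for streams
of square pieces, there exists a nonempty finite stream `L` of square pieces
with `ALG_σ(L) ≥ (16/9) * OPT(L)` (area of the smallest axis-parallel
bounding square). -/
theorem square_in_square_lower_bound
    (σ : List ℝ → ℝ × ℝ) (hσ : SqStrategyValid σ) :
    ∃ L : List ℝ, L ≠ [] ∧ (∀ s ∈ L, 0 < s) ∧
      (16 / 9 : ℝ) * optSq L ≤ algSq σ L := by
  have hU : ∀ s ∈ ([1, 1, 1, 1] : List ℝ), 0 < s := by simp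
  have hV : ∀ s ∈ ([1, 1, 1, 1, 2] : List ℝ), 0 < s := by simp
  by_contra! hcon
  have hU' := hcon _ (by simp) hU
  have hV' := hcon _ (by simp) hV
  have extU := extent_lt_of_sqCost_lt (c := 3) hU (by norm_num)
    (hU'.trans_le (by linarith [optSq_four_unit_squares_le]))
  have extV := extent_lt_of_sqCost_lt (c := 4) hV (by norm_num)
    (hV'.trans_le (by linarith [optSq_four_unit_squares_and_two_le]))
  have getU (i : Fin 4) : ([1, 1, 1, 1] : List ℝ).get i = 1 := by fin_cases i <;> rfl
  have getV (i : Fin 4) : ([1, 1, 1, 1, 2] : List ℝ).get i.castSucc = 1 := by fin_cases i <;> rfl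
  have posV (i : Fin 4) : onlineSqPos σ [1, 1, 1, 1, 2] i.castSucc
      = onlineSqPos σ [1, 1, 1, 1] i := by fin_cases i <;> rfl
  refine no_square_of_side_two (onlineSqPos σ [1, 1, 1, 1])
    (onlineSqPos σ [1, 1, 1, 1, 2] (Fin.last 4)) (fun i j hij => ?_) (fun i j => ?_)
    (fun i => ?_) (fun i => ?_) (fun i => ?_)
  · have h := hσ.separated hU hij
    rwa [getU, getU] at h
  · have h := extU i j
    rwa [getU] at h
  · have h := hσ.separated hV (Fin.castSucc_lt_last i).ne
    rwa [getV, posV] at h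
  · have h := extV (Fin.last 4) i.castSucc
    rwa [getV, posV] at h
  · have h := extV i.castSucc (Fin.last 4)
    rwa [posV] at h
end
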